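/- arXiv:math-ph/9906013 — 2 statements merged into one kernel-verified Lean document; each statement's English description precedes it below -/
import Mathlib

section
/- Let n ≥ 1, let A be a positive semidefinite Hermitian n×n complex matrix, let (Ω, g) be a probability space, and let ω ↦ U(ω) be a measurable family of unitary n×n complex matrices such that the matrix-valued function ω ↦ U(ω)* A U(ω) is Bochner integrable. Set B := ∫_Ω U(ω)* A U(ω) dg(ω). Then B is Hermitian positive semidefinite, and for every k with 1 ≤ k ≤ n, the sum of the k largest eigenvalues of B (counted with multiplicity) is at most the sum of the k largest eigenvalues of A (counted with multiplicity). -/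
open MeasureTheory Matrix
open scoped ComplexOrder

/-- Among the `k`-element index sets there is one, `t`, on which `a` is as large as possible:
no `[0, 1]`-valued weight of total mass `k` yields a larger weighted sum than the indicator
of `t`. -/
theorem exists_finset_forall_sum_mul_le {ι : Type*} [Fintype ι] [DecidableEq ι] (a : ι → ℝ)
    {k : ℕ} (hk : 1 ≤ k) (hkn : k ≤ Fintype.card ι) :
    ∃ t : Finset ι, t.card = k ∧ ∀ c : ι → ℝ, (∀ j, 0 ≤ c j) → (∀ j, c j ≤ 1) →
      ∑ j, c j = k → ∑ j, a j * c j ≤ ∑ j ∈ t, a j := by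
  obtain ⟨t, ht, hmax⟩ := Finset.exists_max_image (Finset.powersetCard k Finset.univ)
    (fun t : Finset ι => ∑ j ∈ t, a j) (Finset.powersetCard_nonempty.2 (by simpa using hkn))
  have htk : t.card = k := (Finset.mem_powersetCard.1 ht).2
  have hswap : ∀ i ∈ t, ∀ j ∉ t, a j ≤ a i := by
    intro i hi j hj
    have hj' : j ∉ t.erase i := fun h => hj (Finset.mem_of_mem_erase h)
    have h := hmax (insert j (t.erase i)) (by
      rw [Finset.mem_powersetCard, Finset.card_insert_of_notMem hj', Finset.card_erase_of_mem hi]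
      exact ⟨Finset.subset_univ _, by omega⟩)
    rw [Finset.sum_insert hj', ← Finset.add_sum_erase t a hi] at h
    linarith
  obtain ⟨m, hm, hmin⟩ := Finset.exists_min_image t a (Finset.card_pos.1 (by omega))
  refine ⟨t, htk, fun c hc0 hc1 hc => ?_⟩
  have hpoint : ∀ j, a j * c j - (if j ∈ t then a j else 0) ≤
      a m * (c j - if j ∈ t then 1 else 0) := by
    intro j
    by_cases hj : j ∈ t
    · simp only [hj, if_true]
      nlinarith [hmin j hj, hc1 j]
    · simp only [hj, if_false]
      nlinarith [hswap m hm j hj, hc0 j]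
  have h := Finset.sum_le_sum fun j (_ : j ∈ Finset.univ) => hpoint j
  rw [← Finset.mul_sum, Finset.sum_sub_distrib, Finset.sum_sub_distrib, hc] at h
  simp only [Finset.sum_ite_mem, Finset.univ_inter, Finset.sum_const, htk, nsmul_eq_mul,
    mul_one, sub_self, mul_zero] at h
  linarith

/-- Partial traces of unitary conjugates of a Hermitian matrix are bounded by a sum of
eigenvalues. -/
theorem Matrix.IsHermitian.exists_finset_forall_sum_diag_le {n : Type*} [Fintype n]
    [DecidableEq n] {A : Matrix n n ℂ} (hA : A.IsHermitian) {k : ℕ} (hk : 1 ≤ k)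
    (hkn : k ≤ Fintype.card n) :
    ∃ t : Finset n, t.card = k ∧ ∀ X ∈ unitaryGroup n ℂ, ∀ s : Finset n, s.card = k →
      ∑ i ∈ s, ((Xᴴ * A * X) i i).re ≤ ∑ i ∈ t, hA.eigenvalues i := by
  obtain ⟨t, ht, hle⟩ := exists_finset_forall_sum_mul_le hA.eigenvalues hk hkn
  refine ⟨t, ht, fun X hX s hs => ?_⟩
  set W : Matrix n n ℂ := hA.eigenvectorUnitary.1
  set Y := Wᴴ * X with hY
  have hYmem : Y ∈ unitaryGroup n ℂ :=
    mul_mem (Unitary.star_mem (hA.eigenvectorUnitary).2) hX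
  have hspec : A = W * diagonal (fun j => (hA.eigenvalues j : ℂ)) * Wᴴ := hA.spectral_theorem
  have hconj : Xᴴ * A * X = Yᴴ * diagonal (fun j => (hA.eigenvalues j : ℂ)) * Y := by
    rw [hY, conjTranspose_mul, conjTranspose_conjTranspose]
    conv_lhs => rw [hspec]
    simp only [Matrix.mul_assoc]
  have hcol : ∀ i, ∑ j, Complex.normSq (Y j i) = 1 := by
    intro i
    have h := congrFun (congrFun (mem_unitaryGroup_iff'.1 hYmem) i) i
    rw [star_eq_conjTranspose, mul_apply, one_apply_eq] at h
    simp only [conjTranspose_apply, RCLike.star_def, ← Complex.normSq_eq_conj_mul_self] at h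
    exact_mod_cast h
  have hrow : ∀ j, ∑ i, Complex.normSq (Y j i) = 1 := by
    intro j
    have h := congrFun (congrFun (mem_unitaryGroup_iff.1 hYmem) j) j
    rw [star_eq_conjTranspose, mul_apply, one_apply_eq] at h
    simp only [conjTranspose_apply, RCLike.star_def, Complex.mul_conj] at h
    exact_mod_cast h
  have hdiag : ∀ i, ((Xᴴ * A * X) i i).re =
      ∑ j, hA.eigenvalues j * Complex.normSq (Y j i) := by
    intro i
    rw [hconj, mul_apply, Complex.re_sum]
    refine Finset.sum_congr rfl fun j _ => ?_
    rw [mul_diagonal, conjTranspose_apply, RCLike.star_def, mul_right_comm,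
      ← Complex.normSq_eq_conj_mul_self, ← Complex.ofReal_mul, Complex.ofReal_re, mul_comm]
  simp only [hdiag]
  rw [Finset.sum_comm]
  simp only [← Finset.mul_sum]
  refine hle _ (fun j => Finset.sum_nonneg fun i _ => Complex.normSq_nonneg _) (fun j => ?_) ?_
  · rw [← hrow j]
    exact Finset.sum_le_univ_sum_of_nonneg fun i => Complex.normSq_nonneg _
  · rw [Finset.sum_comm]
    simp [hcol, hs]

section EntrywiseIntegral

variable {Ω m n p q : Type*} [MeasurableSpace Ω] {μ : Measure Ω} [Fintype n] [Fintype p]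
  {M : Ω → Matrix n p ℂ}

theorem integrable_mul_mul_apply (hM : ∀ i j, Integrable (fun ω => M ω i j) μ)
    (P : Matrix m n ℂ) (Q : Matrix p q ℂ) (i : m) (j : q) :
    Integrable (fun ω => (P * M ω * Q) i j) μ := by
  simp only [mul_apply]
  exact integrable_finsetSum _ fun y _ =>
    (integrable_finsetSum _ fun x _ => (hM x y).const_mul _).mul_const _

theorem integral_mul_mul_apply (hM : ∀ i j, Integrable (fun ω => M ω i j) μ)
    (P : Matrix m n ℂ) (Q : Matrix p q ℂ) (i : m) (j : q) :
    ∫ ω, (P * M ω * Q) i j ∂μ = (P * Matrix.of (fun x y => ∫ ω, M ω x y ∂μ) * Q) i j := by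
  simp only [mul_apply, of_apply]
  have h : ∀ y, Integrable (fun ω => ∑ x, P i x * M ω x y) μ := fun y =>
    integrable_finsetSum _ fun x _ => (hM x y).const_mul _
  rw [integral_finsetSum _ fun y _ => (h y).mul_const _]
  refine Finset.sum_congr rfl fun y _ => ?_
  rw [integral_mul_const, integral_finsetSum _ fun x _ => (hM x y).const_mul _]
  simp only [integral_const_mul]

end EntrywiseIntegral

/-- The entrywise integral of positive semidefinite matrices is positive semidefinite. -/
theorem posSemidef_of_integral {Ω n : Type*} [MeasurableSpace Ω] {μ : Measure Ω} [Fintype n]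
    {M : Ω → Matrix n n ℂ} (hM : ∀ i j, Integrable (fun ω => M ω i j) μ)
    (hpos : ∀ ω, (M ω).PosSemidef) :
    (Matrix.of fun i j => ∫ ω, M ω i j ∂μ).PosSemidef := by
  refine PosSemidef.of_dotProduct_mulVec_nonneg ?_ fun x => ?_
  · ext i j
    rw [conjTranspose_apply, of_apply, of_apply, RCLike.star_def, ← integral_conj]
    exact integral_congr_ae (Filter.Eventually.of_forall fun ω => (hpos ω).1.apply i j)
  · have key : ∀ N : Matrix n n ℂ, star x ⬝ᵥ (N *ᵥ x) =
        ((replicateCol Unit x)ᴴ * N * replicateCol Unit x) () () := by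
      intro N
      rw [Matrix.mul_assoc]
      rfl
    rw [key, ← integral_mul_mul_apply hM]
    refine integral_nonneg fun ω => ?_
    change 0 ≤ _
    rw [← key]
    exact (hpos ω).dotProduct_mulVec_nonneg x

/-- **Majorization lemma.** An average `B = ∫ U(ω)* A U(ω) dg(ω)` of unitary conjugates of a
positive semidefinite Hermitian matrix `A` over a probability space is positive semidefinite
and is majorized by `A`: every partial sum of the `k` largest eigenvalues of `B` is dominated
by the corresponding partial sum for `A`. -/
theorem majorization_of_unitary_average
    {n : ℕ} (hn : 1 ≤ n)
    (A : Matrix (Fin n) (Fin n) ℂ) (hA : A.PosSemidef)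
    {Ω : Type*} [MeasurableSpace Ω] (g : Measure Ω) [IsProbabilityMeasure g]
    (U : Ω → Matrix (Fin n) (Fin n) ℂ)
    (hU : ∀ ω, (U ω)ᴴ * U ω = 1 ∧ U ω * (U ω)ᴴ = 1)
    (hmeas : ∀ i j, Measurable fun ω => ((U ω)ᴴ * A * U ω) i j)
    (hint : ∀ i j, Integrable (fun ω => ((U ω)ᴴ * A * U ω) i j) g)
    (B : Matrix (Fin n) (Fin n) ℂ)
    (hB : ∀ i j, B i j = ∫ ω, ((U ω)ᴴ * A * U ω) i j ∂g) :
    ∃ hBpsd : B.PosSemidef,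
      ∀ k : ℕ, 1 ≤ k → k ≤ n →
        ∀ s : Finset (Fin n), s.card = k →
          ∃ t : Finset (Fin n), t.card = k ∧
            (∑ i ∈ s, hBpsd.1.eigenvalues i) ≤ ∑ i ∈ t, hA.1.eigenvalues i := by
  have hBeq : B = Matrix.of fun i j => ∫ ω, ((U ω)ᴴ * A * U ω) i j ∂g := by
    ext i j
    exact hB i j
  have hBpsd : B.PosSemidef :=
    hBeq ▸ posSemidef_of_integral hint fun ω => hA.conjTranspose_mul_mul_same (U ω)
  refine ⟨hBpsd, fun k hk hkn s hs => ?_⟩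
  obtain ⟨t, ht, hle⟩ := hA.1.exists_finset_forall_sum_diag_le hk (by simpa using hkn)
  refine ⟨t, ht, ?_⟩
  set V : Matrix (Fin n) (Fin n) ℂ := hBpsd.1.eigenvectorUnitary.1
  have hVint := integrable_mul_mul_apply hint Vᴴ V
  have hVre : ∀ i, Integrable (fun ω => ((Vᴴ * ((U ω)ᴴ * A * U ω) * V) i i).re) g :=
    fun i => (hVint i i).re
  have heig : ∀ i, hBpsd.1.eigenvalues i =
      ∫ ω, ((Vᴴ * ((U ω)ᴴ * A * U ω) * V) i i).re ∂g := by
    intro i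
    have hdiag : Vᴴ * B * V = diagonal (fun j => (hBpsd.1.eigenvalues j : ℂ)) := by
      have h := hBpsd.1.conjStarAlgAut_star_eigenvectorUnitary
      rwa [Unitary.conjStarAlgAut_star_apply] at h
    have hre := integral_re (hVint i i)
    rw [integral_mul_mul_apply hint, ← hBeq, hdiag, diagonal_apply_eq] at hre
    exact hre.symm
  rw [Finset.sum_congr rfl fun i _ => heig i, ← integral_finsetSum _ fun i _ => hVre i]
  calc ∫ ω, ∑ i ∈ s, ((Vᴴ * ((U ω)ᴴ * A * U ω) * V) i i).re ∂g
      ≤ ∫ _, ∑ i ∈ t, hA.1.eigenvalues i ∂g := by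
        refine integral_mono (integrable_finsetSum _ fun i _ => hVre i)
          (integrable_const _) fun ω => ?_
        have hUV : U ω * V ∈ unitaryGroup (Fin n) ℂ :=
          mul_mem (mem_unitaryGroup_iff.2 (hU ω).2) hBpsd.1.eigenvectorUnitary.2
        simpa only [conjTranspose_mul, Matrix.mul_assoc] using hle _ hUV s hs
    _ = ∑ i ∈ t, hA.1.eigenvalues i := by simp
end

section
/- Let n ≥ 1 and let V : ℝ → M_n(ℂ) be a continuous function whose values are Hermitian nonpositive matrices (V(x) ≤ 0), such that x ↦ tr(−V(x)) is Lebesgue integrable on ℝ. Let ψ_1, …, ψ_N : ℝ → ℂ^n be twice continuously differentiable, square-integrable functions forming an orthonormal family in L²(ℝ, ℂ^n), and let E_1, …, E_N > 0 satisfy −ψ_j″(x) + V(x)ψ_j(x) = −E_j ψ_j(x) for all x ∈ ℝ and each j. Then ∑_{j=1}^N √(E_j) ≤ (1/2) ∫_ℝ tr(−V(x)) dx. -/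
open MeasureTheory Matrix
open scoped ComplexOrder
open scoped FourierTransform BoundedContinuousFunction

/-! ### The exponential kernel -/

/-- `e^{-δ|t|}` is the characteristic function of a probability measure. -/
lemma exists_probabilityMeasure_integral_exp_eq (δ : ℝ) (hδ : 0 < δ) :
    ∃ μ : Measure ℝ, IsProbabilityMeasure μ ∧
      ∀ t : ℝ, ∫ q, Complex.exp (2 * Real.pi * q * t * Complex.I) ∂μ
        = (Real.exp (-δ * |t|) : ℂ) := by
  set f : ℝ → ℂ := fun x => (Real.exp (-δ * |x|) : ℂ) with hf
  set g : ℝ → ℝ := fun w => 2 * δ / (δ ^ 2 + (2 * Real.pi * w) ^ 2) with hg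
  have hpos : ∀ w, 0 < δ ^ 2 + (2 * Real.pi * w) ^ 2 := fun w => by positivity
  have hfc : Continuous f := by fun_prop
  have hexp : ∀ w : ℝ, 𝓕 f w = ∫ x : ℝ, Complex.exp (-(2 * Real.pi * w * Complex.I) * x) * f x := by
    intro w
    rw [Real.fourier_real_eq_integral_exp_smul]
    refine integral_congr_ae (.of_forall fun x => ?_)
    simp only [smul_eq_mul]
    congr 2
    push_cast
    ring
  have hI : ∀ w : ℝ, ∀ x ∈ Set.Iic (0 : ℝ), Complex.exp ((δ - 2 * Real.pi * w * Complex.I) * x)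
      = Complex.exp (-(2 * Real.pi * w * Complex.I) * x) * f x := by
    intro w x hx
    simp only [hf, Complex.ofReal_exp, ← Complex.exp_add, abs_of_nonpos (Set.mem_Iic.1 hx)]
    congr 1
    push_cast
    ring
  have hJ : ∀ w : ℝ, ∀ x ∈ Set.Ioi (0 : ℝ), Complex.exp ((-δ - 2 * Real.pi * w * Complex.I) * x)
      = Complex.exp (-(2 * Real.pi * w * Complex.I) * x) * f x := by
    intro w x hx
    simp only [hf, Complex.ofReal_exp, ← Complex.exp_add, abs_of_pos (Set.mem_Ioi.1 hx)]
    congr 1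
    push_cast
    ring
  have hre1 : ∀ w : ℝ, 0 < ((δ : ℂ) - 2 * Real.pi * w * Complex.I).re := by intro w; simp [hδ]
  have hre2 : ∀ w : ℝ, (-(δ : ℂ) - 2 * Real.pi * w * Complex.I).re < 0 := by intro w; simp [hδ]
  have hi1 : ∀ w : ℝ, IntegrableOn
      (fun x : ℝ => Complex.exp (-(2 * Real.pi * w * Complex.I) * x) * f x) (Set.Iic 0) := fun w =>
    (integrableOn_exp_mul_complex_Iic (hre1 w) 0).congr_fun (hI w) measurableSet_Iic
  have hi2 : ∀ w : ℝ, IntegrableOn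
      (fun x : ℝ => Complex.exp (-(2 * Real.pi * w * Complex.I) * x) * f x) (Set.Ioi 0) := fun w =>
    (integrableOn_exp_mul_complex_Ioi (hre2 w) 0).congr_fun (hJ w) measurableSet_Ioi
  have hfi : Integrable f := by
    have := (hi1 0).union (hi2 0)
    rw [Set.Iic_union_Ioi, integrableOn_univ] at this
    simpa using this
  have hF : 𝓕 f = fun w => (g w : ℂ) := by
    ext w
    rw [hexp, ← integral_add_compl (s := Set.Iic 0) measurableSet_Iic
      (by have := (hi1 w).union (hi2 w)
          rwa [Set.Iic_union_Ioi, integrableOn_univ] at this), Set.compl_Iic,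
      ← setIntegral_congr_fun measurableSet_Iic (hI w),
      ← setIntegral_congr_fun measurableSet_Ioi (hJ w),
      integral_exp_mul_complex_Iic (hre1 w), integral_exp_mul_complex_Ioi (hre2 w)]
    have h1 : (δ : ℂ) - 2 * Real.pi * w * Complex.I ≠ 0 := fun h => by
      have := hre1 w; rw [h] at this; simp at this
    have h2 : -(δ : ℂ) - 2 * Real.pi * w * Complex.I ≠ 0 := fun h => by
      have := hre2 w; rw [h] at this; simp at this
    have h3 : (δ : ℂ) ^ 2 + (2 * Real.pi * w) ^ 2 ≠ 0 := by
      exact_mod_cast (hpos w).ne'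
    simp only [hg, Complex.ofReal_zero, mul_zero, Complex.exp_zero]
    push_cast
    rw [div_add_div _ _ h1 h2, div_eq_div_iff (mul_ne_zero h1 h2) h3]
    linear_combination (-2 * δ * (2 * Real.pi * w) ^ 2 : ℂ) * Complex.I_sq
  have hgi : Integrable g := by
    have h := (integrable_inv_one_add_sq.comp_mul_left' (g := fun x : ℝ => (1 + x ^ 2)⁻¹)
      (R := 2 * Real.pi / δ) (by positivity)).const_mul (2 / δ)
    refine h.congr (.of_forall fun w => ?_)
    simp only [hg]
    have := (hpos w).ne'
    field_simp
  have hinv := hfc.fourierInv_fourier_eq hfi (by rw [hF]; exact hgi.ofReal)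
  have key : ∀ t : ℝ, ∫ q, Complex.exp (2 * Real.pi * q * t * Complex.I)
      ∂(volume.withDensity fun q => ENNReal.ofReal (g q)) = f t := by
    intro t
    rw [integral_withDensity_eq_integral_toReal_smul (by fun_prop)
      (.of_forall fun _ => ENNReal.ofReal_lt_top), ← congrFun hinv t, hF,
      Real.fourierInv_eq']
    refine integral_congr_ae (.of_forall fun q => ?_)
    have : 0 ≤ g q := div_nonneg (by positivity) (hpos q).le
    simp only [ENNReal.toReal_ofReal this, Complex.real_smul, smul_eq_mul]
    rw [mul_comm]
    congr 2
    simp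
    ring
  refine ⟨_, ⟨?_⟩, key⟩
  have h0 := key 0
  simp only [hf] at h0
  simp only [Complex.ofReal_zero, mul_zero, zero_mul, Complex.exp_zero, integral_const, abs_zero,
    Real.exp_zero, Complex.ofReal_one, Complex.real_smul, mul_one] at h0
  have h1 : Measure.real (volume.withDensity fun q => ENNReal.ofReal (g q)) Set.univ = 1 := by
    exact_mod_cast h0
  rwa [Measure.real, ENNReal.toReal_eq_one_iff] at h1

/-- The sesquilinear form on integrable functions with kernel `e^{-ε|x-y|}`. -/
noncomputable def kernelForm (ε : ℝ) (h₁ h₂ : ℝ → ℂ) : ℂ :=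
  ∫ z : ℝ × ℝ, (Real.exp (-ε * |z.1 - z.2|) : ℂ) * ((starRingEnd ℂ) (h₁ z.1) * h₂ z.2)
    ∂(volume.prod volume)

lemma integrable_conj {h : ℝ → ℂ} (hh : Integrable h) :
    Integrable fun x => (starRingEnd ℂ) (h x) :=
  hh.norm.mono' (Complex.continuous_conj.comp_aestronglyMeasurable hh.1) (by simp)

lemma norm_exp_neg_mul_abs_le {ε : ℝ} (hε : 0 ≤ ε) (t : ℝ) :
    ‖(Real.exp (-ε * |t|) : ℂ)‖ ≤ 1 := by
  rw [Complex.norm_real, Real.norm_eq_abs, Real.abs_exp, Real.exp_le_one_iff]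
  nlinarith [abs_nonneg t]

lemma integrable_kernelForm {ε : ℝ} (hε : 0 ≤ ε) {h₁ h₂ : ℝ → ℂ} (i₁ : Integrable h₁)
    (i₂ : Integrable h₂) :
    Integrable (fun z : ℝ × ℝ => (Real.exp (-ε * |z.1 - z.2|) : ℂ) *
      ((starRingEnd ℂ) (h₁ z.1) * h₂ z.2)) (volume.prod volume) :=
  ((integrable_conj i₁).mul_prod i₂).bdd_mul (c := 1)
    (Continuous.aestronglyMeasurable (by fun_prop))
    (.of_forall fun z => norm_exp_neg_mul_abs_le hε _)

lemma integrable_exp_kernel_mul {ε : ℝ} (hε : 0 ≤ ε) {h : ℝ → ℂ} (i : Integrable h) (x : ℝ) :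
    Integrable fun y : ℝ => (Real.exp (-ε * |x - y|) : ℂ) * h y :=
  i.bdd_mul (c := 1) (Continuous.aestronglyMeasurable (by fun_prop))
    (.of_forall fun z => norm_exp_neg_mul_abs_le hε _)

lemma kernelForm_eq_integral {ε : ℝ} (hε : 0 ≤ ε) {h₁ h₂ : ℝ → ℂ} (i₁ : Integrable h₁)
    (i₂ : Integrable h₂) :
    kernelForm ε h₁ h₂
      = ∫ x, (starRingEnd ℂ) (h₁ x) * ∫ y : ℝ, (Real.exp (-ε * |x - y|) : ℂ) * h₂ y := by
  rw [kernelForm, integral_prod _ (integrable_kernelForm hε i₁ i₂)]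
  refine integral_congr_ae (.of_forall fun x => ?_)
  simp only
  rw [← integral_const_mul]
  refine integral_congr_ae (.of_forall fun y => ?_)
  simp only
  ring

lemma kernelForm_conj (ε : ℝ) (h₁ h₂ : ℝ → ℂ) :
    (starRingEnd ℂ) (kernelForm ε h₁ h₂) = kernelForm ε h₂ h₁ := by
  rw [kernelForm, kernelForm, ← integral_conj, ← integral_prod_swap]
  refine integral_congr_ae (.of_forall fun z => ?_)
  simp only [map_mul, Complex.conj_ofReal, Complex.conj_conj, Prod.fst_swap, Prod.snd_swap,
    abs_sub_comm z.2 z.1]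
  ring

lemma kernelForm_add_left {ε : ℝ} (hε : 0 ≤ ε) {h₁ h₂ h₃ : ℝ → ℂ} (i₁ : Integrable h₁)
    (i₂ : Integrable h₂) (i₃ : Integrable h₃) :
    kernelForm ε (fun x => h₁ x + h₂ x) h₃ = kernelForm ε h₁ h₃ + kernelForm ε h₂ h₃ := by
  rw [kernelForm, kernelForm, kernelForm,
    ← integral_add (integrable_kernelForm hε i₁ i₃) (integrable_kernelForm hε i₂ i₃)]
  refine integral_congr_ae (.of_forall fun z => ?_)
  simp only [map_add]
  ring

lemma kernelForm_add_right {ε : ℝ} (hε : 0 ≤ ε) {h₁ h₂ h₃ : ℝ → ℂ} (i₁ : Integrable h₁)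
    (i₂ : Integrable h₂) (i₃ : Integrable h₃) :
    kernelForm ε h₃ (fun x => h₁ x + h₂ x) = kernelForm ε h₃ h₁ + kernelForm ε h₃ h₂ := by
  rw [← kernelForm_conj, kernelForm_add_left hε i₁ i₂ i₃, map_add, kernelForm_conj,
    kernelForm_conj]

lemma kernelForm_smul (ε : ℝ) (c : ℂ) (h : ℝ → ℂ) :
    kernelForm ε (fun x => c * h x) (fun x => c * h x) = (Complex.normSq c) * kernelForm ε h h := by
  rw [kernelForm, kernelForm, ← integral_const_mul]
  refine integral_congr_ae (.of_forall fun z => ?_)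
  simp only [map_mul, Complex.normSq_eq_conj_mul_self]
  ring

lemma kernelForm_zero (h : ℝ → ℂ) :
    kernelForm 0 h h = (Complex.normSq (∫ x, h x) : ℂ) := by
  rw [kernelForm, Complex.normSq_eq_conj_mul_self, ← integral_conj, ← integral_prod_mul]
  simp

/-- Multiplication of a scalar function by the character `e^{2πiqx}`. -/
noncomputable def modulate (q : ℝ) (h : ℝ → ℂ) (x : ℝ) : ℂ :=
  Complex.exp (2 * Real.pi * q * x * Complex.I) * h x

lemma kernelForm_modulate (ε q : ℝ) (h : ℝ → ℂ) :
    kernelForm ε (modulate q h) (modulate q h) = ∫ z : ℝ × ℝ,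
      Complex.exp (2 * Real.pi * q * (z.2 - z.1 : ℝ) * Complex.I) *
      ((Real.exp (-ε * |z.1 - z.2|) : ℂ) * ((starRingEnd ℂ) (h z.1) * h z.2))
      ∂(volume.prod volume) := by
  rw [kernelForm]
  refine integral_congr_ae (.of_forall fun z => ?_)
  have : Complex.exp (2 * Real.pi * q * (z.2 - z.1 : ℝ) * Complex.I)
      = (starRingEnd ℂ) (Complex.exp (2 * Real.pi * q * z.1 * Complex.I))
        * Complex.exp (2 * Real.pi * q * z.2 * Complex.I) := by
    rw [← Complex.exp_conj, ← Complex.exp_add]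
    congr 1
    simp only [map_mul, map_ofNat, Complex.conj_ofReal, Complex.conj_I]
    push_cast
    ring
  simp only [this, modulate, map_mul]
  ring

lemma integrable_modulate_kernel (μ : Measure ℝ) [IsProbabilityMeasure μ] {ε : ℝ} (hε : 0 ≤ ε)
    {h : ℝ → ℂ} (i : Integrable h) :
    Integrable (fun p : ℝ × (ℝ × ℝ) =>
      Complex.exp (2 * Real.pi * p.1 * (p.2.2 - p.2.1 : ℝ) * Complex.I) *
      ((Real.exp (-ε * |p.2.1 - p.2.2|) : ℂ) * ((starRingEnd ℂ) (h p.2.1) * h p.2.2)))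
      (μ.prod (volume.prod volume)) := by
  have h1 := (integrable_const (μ := μ) (1 : ℂ)).mul_prod (integrable_kernelForm hε i i)
  simp only [one_mul] at h1
  refine h1.bdd_mul (c := 1) (Continuous.aestronglyMeasurable (by fun_prop))
    (.of_forall fun p => ?_)
  rw [Complex.norm_exp]
  simp

lemma integrable_kernelForm_modulate (μ : Measure ℝ) [IsProbabilityMeasure μ] {ε : ℝ}
    (hε : 0 ≤ ε) {h : ℝ → ℂ} (i : Integrable h) :
    Integrable (fun q => kernelForm ε (modulate q h) (modulate q h)) μ := by
  simp only [kernelForm_modulate]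
  exact (integrable_modulate_kernel μ hε i).integral_prod_left

/-- The form at a larger parameter is an average of unitary conjugates of the form at a smaller
parameter. -/
lemma exists_kernelForm_add_eq_integral {δ : ℝ} (hδ : 0 < δ) :
    ∃ μ : Measure ℝ, IsProbabilityMeasure μ ∧ ∀ (ε : ℝ), 0 ≤ ε → ∀ h : ℝ → ℂ, Integrable h →
      kernelForm (ε + δ) h h = ∫ q, kernelForm ε (modulate q h) (modulate q h) ∂μ := by
  obtain ⟨μ, hμ, hμδ⟩ := exists_probabilityMeasure_integral_exp_eq δ hδ
  refine ⟨μ, hμ, fun ε hε h i => ?_⟩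
  simp only [kernelForm_modulate]
  rw [integral_integral_swap (integrable_modulate_kernel μ hε i), kernelForm]
  refine integral_congr_ae (.of_forall fun z => ?_)
  simp only
  have e : Real.exp (-(ε + δ) * |z.1 - z.2|)
      = Real.exp (-δ * |z.1 - z.2|) * Real.exp (-ε * |z.1 - z.2|) := by
    rw [← Real.exp_add]
    congr 1
    ring
  rw [integral_mul_const, hμδ, abs_sub_comm z.2 z.1, e, Complex.ofReal_mul, mul_assoc]

lemma kernelForm_self_re_nonneg {ε : ℝ} (hε : 0 < ε) {h : ℝ → ℂ} (i : Integrable h) :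
    0 ≤ (kernelForm ε h h).re := by
  obtain ⟨μ, hμ, hμε⟩ := exists_kernelForm_add_eq_integral hε
  have h1 := hμε 0 le_rfl h i
  rw [zero_add] at h1
  have h2 := integrable_kernelForm_modulate μ le_rfl i
  rw [h1, ← RCLike.re_eq_complex_re, ← integral_re h2]
  refine integral_nonneg fun q => ?_
  simp only [kernelForm_zero, RCLike.re_eq_complex_re, Complex.ofReal_re, Pi.zero_apply]
  exact Complex.normSq_nonneg _

/-- Lower bound for the form on `f` if `u` solves `-u'' + ε²u = f - g`, where `g` is regarded as
an error term. -/
lemma two_mul_le_kernelForm_re {ε : ℝ} (hε : 0 < ε) {f g u : ℝ → ℂ} (hf : Integrable f)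
    (hg : Integrable g)
    (hu : ∀ x, ∫ y : ℝ, (Real.exp (-ε * |x - y|) : ℂ) * (f y - g y) = 2 * ε * u x) :
    2 * ε * (∫ x, (starRingEnd ℂ) (f x) * u x).re + 2 * ε * (∫ x, (starRingEnd ℂ) (g x) * u x).re
      ≤ (kernelForm ε f f).re := by
  have hfg : Integrable fun x => f x - g x := hf.sub hg
  have e : ∀ h : ℝ → ℂ, Integrable h → kernelForm ε h f
      = kernelForm ε h (fun x => f x - g x) + kernelForm ε h g := fun h ih => by
    rw [← kernelForm_add_right hε.le hfg hg ih]; simp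
  have e' : ∀ h : ℝ → ℂ, Integrable h → (kernelForm ε h (fun x => f x - g x)).re
      = 2 * ε * (∫ x, (starRingEnd ℂ) (h x) * u x).re := fun h ih => by
    rw [kernelForm_eq_integral hε.le ih hfg]
    simp only [hu]
    have : ∀ x, (starRingEnd ℂ) (h x) * (2 * ε * u x)
      = ((2 * ε : ℝ) : ℂ) * ((starRingEnd ℂ) (h x) * u x) := fun x => by push_cast; ring
    simp only [this]
    rw [integral_const_mul, Complex.re_ofReal_mul]
  have h1 : (kernelForm ε f g).re = (kernelForm ε g f).re := by
    rw [← kernelForm_conj, Complex.conj_re]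
  have h2 := kernelForm_self_re_nonneg hε hg
  rw [e f hf, Complex.add_re, h1, e g hg, Complex.add_re, e' f hf, e' g hg]
  linarith

/-! ### The Green function of `-d²/dx² + ε²` -/

lemma integrable_exp_neg_mul_abs {ε : ℝ} (hε : 0 < ε) :
    Integrable fun x : ℝ => Real.exp (-ε * |x|) := by
  refine .of_integral_ne_zero ?_
  rw [integral_comp_abs (f := fun x => Real.exp (-ε * x)), integral_exp_mul_Ioi (by linarith)]
  simp [hε.ne']

lemma integral_Ioi_exp_kernel_eq {ε C : ℝ} (hε : 0 < ε) {u u' r : ℝ → ℂ}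
    (hu : ∀ x, HasDerivAt u (u' x) x) (hu' : ∀ x, HasDerivAt u' (ε ^ 2 * u x - r x) x)
    (hC : ∀ x, ‖u x‖ ≤ C) (hr : Integrable r) (hrc : Continuous r) (x : ℝ) :
    ∫ y in Set.Ioi x, (Real.exp (-ε * (y - x)) : ℂ) * r y = u' x + ε * u x := by
  have huc : Continuous u := continuous_iff_continuousAt.2 fun x => (hu x).continuousAt
  have hC0 : 0 ≤ C := (norm_nonneg _).trans (hC 0)
  have hgrowth : ∀ y, 0 ≤ y → ‖u' y‖ ≤ (‖u' 0‖ + ∫ t, ‖r t‖) + ε ^ 2 * C * y := by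
    intro y hy
    have hc : Continuous fun t => (ε : ℂ) ^ 2 * u t - r t := by fun_prop
    have h1 := intervalIntegral.integral_eq_sub_of_hasDerivAt (fun t _ => hu' t)
      (hc.intervalIntegrable 0 y)
    have h2 : ‖∫ t in (0 : ℝ)..y, ((ε : ℂ) ^ 2 * u t - r t)‖
        ≤ ∫ t in (0 : ℝ)..y, (ε ^ 2 * C + ‖r t‖) := by
      refine intervalIntegral.norm_integral_le_of_norm_le hy (.of_forall fun t _ => ?_)
        ((continuous_const.add hrc.norm).intervalIntegrable _ _)
      refine (norm_sub_le _ _).trans ?_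
      gcongr
      rw [norm_mul, norm_pow, Complex.norm_real, Real.norm_eq_abs, sq_abs]
      gcongr
      exact hC t
    rw [h1, intervalIntegral.integral_add (by simp) (hrc.norm.intervalIntegrable _ _),
      intervalIntegral.integral_const, intervalIntegral.integral_of_le hy] at h2
    have h3 : ∫ t in Set.Ioc 0 y, ‖r t‖ ≤ ∫ t, ‖r t‖ :=
      setIntegral_le_integral hr.norm (.of_forall fun _ => norm_nonneg _)
    have h4 : ‖u' y‖ ≤ ‖u' 0‖ + ‖u' y - u' 0‖ := by
      have := norm_add_le (u' 0) (u' y - u' 0)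
      simpa using this
    simp only [sub_zero, smul_eq_mul] at h2
    linarith
  have hder : ∀ y ∈ Set.Ici x, HasDerivAt
      (fun y : ℝ => (Real.exp (-ε * (y - x)) : ℂ) * (-u' y - ε * u y))
      ((Real.exp (-ε * (y - x)) : ℂ) * r y) y := by
    intro y _
    have h1 : HasDerivAt (fun y : ℝ => Real.exp (-ε * (y - x)))
        (Real.exp (-ε * (y - x)) * (-ε * 1)) y :=
      (((hasDerivAt_id y).sub_const x).const_mul (-ε)).exp
    refine (h1.ofReal_comp.fun_mul ((hu' y).fun_neg.fun_sub
      ((hu y).const_mul (ε : ℂ)))).congr_deriv ?_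
    push_cast
    ring
  have h_int : IntegrableOn (fun y => (Real.exp (-ε * (y - x)) : ℂ) * r y) (Set.Ioi x) := by
    refine (hr.integrableOn (s := Set.Ioi x)).bdd_mul (c := 1)
      (Continuous.aestronglyMeasurable (by fun_prop)) ?_
    refine (ae_restrict_mem measurableSet_Ioi).mono fun y hy => ?_
    rw [Complex.norm_real, Real.norm_eq_abs, Real.abs_exp, Real.exp_le_one_iff]
    have : 0 < y - x := sub_pos.2 hy
    nlinarith
  have hlim : Filter.Tendsto (fun y : ℝ => (Real.exp (-ε * (y - x)) : ℂ) * (-u' y - ε * u y))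
      Filter.atTop (nhds 0) := by
    set a := (‖u' 0‖ + ∫ t, ‖r t‖) + ε * C with ha
    set b := ε ^ 2 * C with hb
    have t0 := tendsto_rpow_mul_exp_neg_mul_atTop_nhds_zero 0 ε hε
    have t1 := tendsto_rpow_mul_exp_neg_mul_atTop_nhds_zero 1 ε hε
    have t2 := ((t0.const_mul a).add (t1.const_mul b)).const_mul (Real.exp (ε * x))
    simp only [Real.rpow_zero, Real.rpow_one, mul_zero, add_zero] at t2
    refine squeeze_zero_norm' ?_ t2
    filter_upwards [Filter.eventually_ge_atTop 0] with y hy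
    have e : Real.exp (-ε * (y - x)) = Real.exp (ε * x) * Real.exp (-ε * y) := by
      rw [← Real.exp_add]; congr 1; ring
    have h1 : ‖-u' y - ε * u y‖ ≤ a + b * y := by
      refine (norm_sub_le _ _).trans ?_
      rw [norm_neg, norm_mul, Complex.norm_real, Real.norm_eq_abs, abs_of_pos hε]
      have := mul_le_mul_of_nonneg_left (hC y) hε.le
      linarith [hgrowth y hy]
    rw [norm_mul, Complex.norm_real, Real.norm_eq_abs, Real.abs_exp, e]
    calc _ ≤ Real.exp (ε * x) * Real.exp (-ε * y) * (a + b * y) := by gcongr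
      _ = _ := by ring
  rw [integral_Ioi_of_hasDerivAt_of_tendsto' hder h_int hlim]
  simp
  ring

/-- A bounded solution of `-u'' + ε²u = r` is the convolution of `r` with the Green function. -/
lemma integral_exp_kernel_eq {ε C : ℝ} (hε : 0 < ε) {u u' r : ℝ → ℂ}
    (hu : ∀ x, HasDerivAt u (u' x) x) (hu' : ∀ x, HasDerivAt u' (ε ^ 2 * u x - r x) x)
    (hC : ∀ x, ‖u x‖ ≤ C) (hr : Integrable r) (hrc : Continuous r) (x : ℝ) :
    ∫ y : ℝ, (Real.exp (-ε * |x - y|) : ℂ) * r y = 2 * ε * u x := by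
  have hR := integral_Ioi_exp_kernel_eq hε hu hu' hC hr hrc x
  have hL := integral_Ioi_exp_kernel_eq (u := fun y => u (-y)) (u' := fun y => -u' (-y))
    (r := fun y => r (-y)) hε
    (fun y => ((hu (-y)).scomp y (hasDerivAt_neg y)).congr_deriv (by simp))
    (fun y => ((hu' (-y)).scomp y (hasDerivAt_neg y)).neg.congr_deriv (by simp))
    (fun y => hC _) hr.comp_neg (by fun_prop) (-x)
  rw [← integral_comp_neg_Iic] at hL
  rw [← integral_add_compl (s := Set.Iic x) measurableSet_Iic
    (integrable_exp_kernel_mul hε.le hr x), Set.compl_Iic]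
  have e1 : ∫ y in Set.Iic x, (Real.exp (-ε * |x - y|) : ℂ) * r y
      = ∫ y in Set.Iic x, (Real.exp (-ε * (-y - -x)) : ℂ) * r (- -y) := by
    refine setIntegral_congr_fun measurableSet_Iic fun y hy => ?_
    simp only [neg_neg, abs_of_nonneg (sub_nonneg.2 (Set.mem_Iic.1 hy))]
    congr 4
    ring
  have e2 : ∫ y in Set.Ioi x, (Real.exp (-ε * |x - y|) : ℂ) * r y
      = ∫ y in Set.Ioi x, (Real.exp (-ε * (y - x)) : ℂ) * r y := by
    refine setIntegral_congr_fun measurableSet_Ioi fun y hy => ?_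
    simp only [abs_of_neg (sub_neg.2 (Set.mem_Ioi.1 hy)), neg_sub]
  rw [e1, e2, hL, hR]
  simp only [neg_neg]
  ring

lemma integrable_of_bounded_of_hasDerivAt {ε C : ℝ} (hε : 0 < ε) {u u' r : ℝ → ℂ}
    (hu : ∀ x, HasDerivAt u (u' x) x) (hu' : ∀ x, HasDerivAt u' (ε ^ 2 * u x - r x) x)
    (hC : ∀ x, ‖u x‖ ≤ C) (hr : Integrable r) (hrc : Continuous r) : Integrable u := by
  have h1 := (hr.integrable_convolution (ContinuousLinearMap.mul ℝ ℂ)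
    (integrable_exp_neg_mul_abs hε).ofReal (𝕜 := ℝ)).const_mul (1 / (2 * ε) : ℂ)
  refine h1.congr (.of_forall fun x => ?_)
  have h2 := integral_exp_kernel_eq hε hu hu' hC hr hrc x
  have h3 : (ε : ℂ) ≠ 0 := by exact_mod_cast hε.ne'
  have h4 : (convolution r (fun x : ℝ => ((Real.exp (-ε * |x|) : ℝ) : ℂ))
      (ContinuousLinearMap.mul ℝ ℂ) volume) x
      = ∫ y : ℝ, (Real.exp (-ε * |x - y|) : ℂ) * r y := by
    rw [convolution]
    refine integral_congr_ae (.of_forall fun y => ?_)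
    simp [mul_comm]
  simp only
  erw [h4, h2]
  field_simp

/-! ### Boundedness of square-integrable solutions -/

/-- Here `h`, `p`, `s` and `w` play the roles of `|ψ|²`, `Re⟨ψ, ψ'⟩`, `|ψ'|²` and `⟨ψ, Aψ⟩` for a
square-integrable solution of `-ψ'' - Aψ = -Eψ`. -/
lemma exists_forall_le_of_hasDerivAt {E : ℝ} (hE : 0 ≤ E) {h p s w τ : ℝ → ℝ}
    (hh : ∀ x, HasDerivAt h (2 * p x) x) (hp : ∀ x, HasDerivAt p (s x + E * h x - w x) x)
    (hq : ∀ x α β, 0 ≤ α ^ 2 * h x + 2 * α * β * p x + β ^ 2 * s x)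
    (hw : ∀ x, w x ≤ τ x * h x) (hτ : ∀ x, 0 ≤ τ x) (hsc : Continuous s) (hwc : Continuous w)
    (hτc : Continuous τ) (hhi : Integrable h) (hτi : Integrable τ) : ∃ C, ∀ x, h x ≤ C := by
  have hhc : Continuous h := continuous_iff_continuousAt.2 fun x => (hh x).continuousAt
  have hpc : Continuous p := continuous_iff_continuousAt.2 fun x => (hp x).continuousAt
  have h0 : ∀ x, 0 ≤ h x := fun x => by simpa using hq x 1 0
  set H := ∫ x, h x with hH
  set T := ∫ x, τ x with hT
  have hH0 : 0 ≤ H := integral_nonneg h0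
  have hT0 : 0 ≤ T := integral_nonneg hτ
  have le_int : ∀ (f : ℝ → ℝ), Integrable f → (∀ x, 0 ≤ f x) → ∀ a b, a ≤ b →
      ∫ x in a..b, f x ≤ ∫ x, f x := fun f hf h0 a b hab => by
    rw [intervalIntegral.integral_of_le hab]
    exact setIntegral_le_integral hf (.of_forall h0)
  set t := 2 * T + 1 with ht
  have ht0 : 0 < t := by positivity
  set C := t * H + (8 * H + 2 * T * t * H) / t with hC
  have main : ∀ R, 1 ≤ R → ∀ x ∈ Set.Icc (-R) R, (1 - (x / R) ^ 2) ^ 2 * h x ≤ C := by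
    intro R hR
    have hR0 : 0 < R := by linarith
    set χ : ℝ → ℝ := fun x => 1 - (x / R) ^ 2 with hχ
    set χ' : ℝ → ℝ := fun x => -(2 * x / R ^ 2) with hχ'
    have dχ : ∀ x, HasDerivAt χ (χ' x) x := fun x => by
      refine ((((hasDerivAt_id x).div_const R).pow 2).const_sub 1).congr_deriv ?_
      simp [hχ']
      field_simp
    have cχ : Continuous χ := by fun_prop
    have cχ' : Continuous χ' := by fun_prop
    have χ0 : ∀ x ∈ Set.Icc (-R) R, χ x ^ 2 ≤ 1 := fun x hx => by
      have h1 : (x / R) ^ 2 ≤ 1 := by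
        rw [sq_le_one_iff_abs_le_one, abs_div, abs_of_pos hR0, div_le_one hR0]
        exact abs_le.2 hx
      have h2 : 0 ≤ (x / R) ^ 2 := sq_nonneg _
      simp only [hχ]
      nlinarith
    have χ'0 : ∀ x ∈ Set.Icc (-R) R, χ' x ^ 2 ≤ 4 := fun x hx => by
      have h1 : |χ' x| ≤ 2 := by
        simp only [hχ', abs_neg, abs_div, abs_mul, abs_pow, abs_of_pos hR0, abs_two]
        rw [div_le_iff₀ (by positivity)]
        nlinarith [abs_le.2 hx]
      nlinarith [sq_abs (χ' x), abs_nonneg (χ' x)]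
    set D : ℝ → ℝ := fun x => χ x ^ 2 * s x + 2 * χ x * χ' x * p x + χ' x ^ 2 * h x with hD
    have cD : Continuous D := by fun_prop
    have D0 : ∀ x, 0 ≤ D x := fun x => by
      have := hq x (χ' x) (χ x)
      simp only [hD]
      linarith
    set X := ∫ x in (-R)..R, D x with hX
    have hX1 : X = ∫ x in (-R)..R, (χ' x ^ 2 * h x - χ x ^ 2 * (E * h x) + χ x ^ 2 * w x) := by
      have h1 : ∀ x, HasDerivAt (fun x => χ x ^ 2 * p x)
          (D x - (χ' x ^ 2 * h x - χ x ^ 2 * (E * h x) + χ x ^ 2 * w x)) x := fun x => by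
        refine (((dχ x).fun_pow 2).fun_mul (hp x)).congr_deriv ?_
        simp [hD]
        ring
      have h2 := intervalIntegral.integral_eq_sub_of_hasDerivAt (a := -R) (b := R)
        (fun x _ => h1 x) (Continuous.intervalIntegrable (by fun_prop) _ _)
      rw [intervalIntegral.integral_sub (cD.intervalIntegrable _ _)
        (Continuous.intervalIntegrable (by fun_prop) _ _)] at h2
      have h3 : χ R = 0 := by simp [hχ, hR0.ne']
      have h4 : χ (-R) = 0 := by simp [hχ, hR0.ne']
      rw [h3, h4] at h2
      linarith
    have hS : ∀ x ∈ Set.Icc (-R) R, χ x ^ 2 * h x ≤ t * H + X / t := by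
      intro x hx
      have h1 : ∀ x, HasDerivAt (fun x => χ x ^ 2 * h x)
          (2 * χ x * χ' x * h x + 2 * χ x ^ 2 * p x) x := fun x => by
        refine (((dχ x).fun_pow 2).fun_mul (hh x)).congr_deriv ?_
        simp
        ring
      have h2 := intervalIntegral.integral_eq_sub_of_hasDerivAt (a := -R) (b := x)
        (fun x _ => h1 x) (Continuous.intervalIntegrable (by fun_prop) _ _)
      have h4 : χ (-R) = 0 := by simp [hχ, hR0.ne']
      have h5 : ∫ y in (-R)..x, (2 * χ y * χ' y * h y + 2 * χ y ^ 2 * p y)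
          ≤ ∫ y in (-R)..x, (t * h y + D y / t) := by
        refine intervalIntegral.integral_mono_on hx.1
          (Continuous.intervalIntegrable (by fun_prop) _ _)
          (Continuous.intervalIntegrable (by fun_prop) _ _) fun y hy => ?_
        have hy' : y ∈ Set.Icc (-R) R := ⟨hy.1, hy.2.trans hx.2⟩
        have h6 := hq y (t * χ y - χ' y) (-χ y)
        have h7 : t * (t * (χ y ^ 2 * h y)) ≤ t * (t * h y) := by
          have := mul_le_mul_of_nonneg_right (χ0 y hy') (h0 y)
          gcongr
          linarith
        rw [← sub_nonneg]
        have h8 : t * h y + D y / t - (2 * χ y * χ' y * h y + 2 * χ y ^ 2 * p y)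
          = (t * (t * h y) + D y - t * (2 * χ y * χ' y * h y + 2 * χ y ^ 2 * p y)) / t := by
            field_simp
        rw [h8]
        refine div_nonneg ?_ ht0.le
        simp only [hD]
        nlinarith
      have h9 : ∫ y in (-R)..x, (t * h y + D y / t) ≤ t * H + X / t := by
        rw [intervalIntegral.integral_add (Continuous.intervalIntegrable (by fun_prop) _ _)
          (Continuous.intervalIntegrable (by fun_prop) _ _), intervalIntegral.integral_const_mul,
          intervalIntegral.integral_div]
        have h10 : ∫ y in (-R)..x, D y ≤ X :=
          intervalIntegral.integral_mono_interval le_rfl hx.1 hx.2 (.of_forall D0)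
            (cD.intervalIntegrable _ _)
        have h11 := le_int h hhi h0 (-R) x hx.1
        gcongr
      rw [h4] at h2
      linarith
    have hX0 : 0 ≤ X := intervalIntegral.integral_nonneg (by linarith) fun x _ => D0 x
    have hX2 : X ≤ 4 * H + T * (t * H + X / t) := by
      have h1 : X ≤ ∫ x in (-R)..R, (4 * h x + τ x * (t * H + X / t)) := by
        refine hX1.trans_le (intervalIntegral.integral_mono_on (by linarith)
          (Continuous.intervalIntegrable (by fun_prop) _ _)
          (Continuous.intervalIntegrable (by fun_prop) _ _) fun x hx => ?_)
        have h2 := mul_le_mul_of_nonneg_right (χ'0 x hx) (h0 x)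
        have h3 : 0 ≤ χ x ^ 2 * (E * h x) := mul_nonneg (sq_nonneg _) (mul_nonneg hE (h0 x))
        have h4 : χ x ^ 2 * w x ≤ τ x * (t * H + X / t) := by
          calc χ x ^ 2 * w x ≤ χ x ^ 2 * (τ x * h x) := by gcongr; exact hw x
            _ = τ x * (χ x ^ 2 * h x) := by ring
            _ ≤ _ := mul_le_mul_of_nonneg_left (hS x hx) (hτ x)
        linarith
      rw [intervalIntegral.integral_add (Continuous.intervalIntegrable (by fun_prop) _ _)
          (Continuous.intervalIntegrable (by fun_prop) _ _), intervalIntegral.integral_const_mul,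
          intervalIntegral.integral_mul_const] at h1
      have h2 := le_int h hhi h0 (-R) R (by linarith)
      have h3 := le_int τ hτi hτ (-R) R (by linarith)
      have h4 : 0 ≤ t * H + X / t := by positivity
      nlinarith [mul_le_mul_of_nonneg_right h3 h4]
    have hX3 : X ≤ 8 * H + 2 * T * t * H := by
      have h1 : T * (X / t) ≤ X / 2 := by
        rw [← mul_div_assoc, div_le_div_iff₀ ht0 two_pos]
        nlinarith
      linarith
    intro x hx
    refine (hS x hx).trans ?_
    rw [hC]
    gcongr
  refine ⟨2 * C, fun x => ?_⟩
  have hR : 0 < 2 * |x| + 1 := by positivity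
  have h1 := main (2 * |x| + 1) (by linarith [abs_nonneg x]) x
    (abs_le.1 (by linarith [abs_nonneg x]))
  have h2 : (x / (2 * |x| + 1)) ^ 2 ≤ 1 / 4 := by
    have h3 : |x / (2 * |x| + 1)| ≤ 1 / 2 := by
      rw [abs_div, abs_of_pos hR, div_le_div_iff₀ hR two_pos]
      linarith
    nlinarith [sq_abs (x / (2 * |x| + 1)), abs_nonneg (x / (2 * |x| + 1))]
  have h4 : 1 / 2 ≤ (1 - (x / (2 * |x| + 1)) ^ 2) ^ 2 := by nlinarith
  nlinarith [mul_le_mul_of_nonneg_right h4 (h0 x)]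

/-! ### The semi-inner product given by the potential -/

/-- Continuous positive semidefinite matrix functions with integrable trace. -/
structure IsIntegrablePotential {n : ℕ} (A : ℝ → Matrix (Fin n) (Fin n) ℂ) : Prop where
  continuous : Continuous A
  posSemidef : ∀ x, (A x).PosSemidef
  integrable_trace : Integrable fun x => (A x).trace.re

open scoped MatrixOrder Matrix.Norms.L2Operator in
lemma Matrix.PosSemidef.norm_apply_le_trace {n : ℕ} {A : Matrix (Fin n) (Fin n) ℂ}
    (hA : A.PosSemidef) (a b : Fin n) : ‖A a b‖ ≤ A.trace.re := by
  obtain ⟨B, rfl⟩ := CStarAlgebra.nonneg_iff_eq_star_mul_self.mp hA.nonneg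
  have hd : ∀ a, ((star B * B) a a).re = ∑ k, ‖B k a‖ ^ 2 := fun a => by
    simp [Matrix.mul_apply, Matrix.star_apply, Complex.sq_norm, Complex.normSq_apply]
  have ht : (star B * B).trace.re = ∑ a, ∑ k, ‖B k a‖ ^ 2 := by
    simp only [Matrix.trace, Matrix.diag, Complex.re_sum, hd]
  have hle : ∀ a, ∑ k, ‖B k a‖ ^ 2 ≤ (star B * B).trace.re := fun a => by
    rw [ht]
    exact Finset.single_le_sum (f := fun a => ∑ k, ‖B k a‖ ^ 2)
      (fun i _ => Finset.sum_nonneg fun _ _ => sq_nonneg _) (Finset.mem_univ a)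
  have h1 : ‖(star B * B) a b‖ ≤ ∑ k, (‖B k a‖ ^ 2 + ‖B k b‖ ^ 2) / 2 := by
    rw [Matrix.mul_apply]
    refine norm_sum_le_of_le _ fun k _ => ?_
    rw [Matrix.star_apply, norm_mul, norm_star]
    nlinarith [sq_nonneg (‖B k a‖ - ‖B k b‖)]
  rw [← Finset.sum_div, Finset.sum_add_distrib] at h1
  linarith [hle a, hle b]

namespace IsIntegrablePotential

variable {n : ℕ} {A : ℝ → Matrix (Fin n) (Fin n) ℂ}

lemma continuous_apply (hA : IsIntegrablePotential A) (a b : Fin n) :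
    Continuous fun x => A x a b := hA.continuous.matrix_elem a b

lemma integrable_apply (hA : IsIntegrablePotential A) (a b : Fin n) :
    Integrable fun x => A x a b :=
  hA.integrable_trace.mono' (hA.continuous_apply a b).aestronglyMeasurable
    (.of_forall fun x => (hA.posSemidef x).norm_apply_le_trace a b)

lemma continuous_mulVec (hA : IsIntegrablePotential A) (v : ℝ →ᵇ (Fin n → ℂ)) (a : Fin n) :
    Continuous fun x => (A x *ᵥ v x) a :=
  (_root_.continuous_apply a).comp (hA.continuous.matrix_mulVec v.continuous)

lemma integrable_mulVec (hA : IsIntegrablePotential A) (v : ℝ →ᵇ (Fin n → ℂ)) (a : Fin n) :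
    Integrable fun x => (A x *ᵥ v x) a := by
  simp only [Matrix.mulVec, dotProduct]
  refine integrable_finsetSum _ fun b _ => (hA.integrable_apply a b).mul_bdd (c := ‖v‖)
    (Continuous.aestronglyMeasurable (by fun_prop)) (.of_forall fun x => ?_)
  exact (norm_le_pi_norm _ _).trans (v.norm_coe_le_norm x)

lemma integrable_form (hA : IsIntegrablePotential A) (v w : ℝ →ᵇ (Fin n → ℂ)) :
    Integrable fun x => star (v x) ⬝ᵥ (A x *ᵥ w x) := by
  simp only [dotProduct]
  refine integrable_finsetSum _ fun a _ => (hA.integrable_mulVec w a).bdd_mul (c := ‖v‖)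
    (Continuous.aestronglyMeasurable (by simp only [Pi.star_apply]; fun_prop))
    (.of_forall fun x => ?_)
  rw [Pi.star_apply, norm_star]
  exact (norm_le_pi_norm _ _).trans (v.norm_coe_le_norm x)

/-- The semi-inner product `∫ ⟨v, A w⟩`. -/
noncomputable def form (hA : IsIntegrablePotential A) :
    (ℝ →ᵇ (Fin n → ℂ)) →ₗ⋆[ℂ] (ℝ →ᵇ (Fin n → ℂ)) →ₗ[ℂ] ℂ :=
  LinearMap.mk₂'ₛₗ (starRingEnd ℂ) (RingHom.id ℂ)
    (fun v w => ∫ x, star (v x) ⬝ᵥ (A x *ᵥ w x))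
    (fun v v' w => by
      rw [← integral_add (hA.integrable_form v w) (hA.integrable_form v' w)]
      simp [add_dotProduct])
    (fun c v w => by
      rw [smul_eq_mul, ← integral_const_mul]
      simp [star_smul, smul_dotProduct])
    (fun v w w' => by
      rw [← integral_add (hA.integrable_form v w) (hA.integrable_form v w')]
      simp [Matrix.mulVec_add, dotProduct_add])
    (fun c v w => by
      rw [RingHom.id_apply, smul_eq_mul, ← integral_const_mul]
      simp [Matrix.mulVec_smul, dotProduct_smul])

lemma form_apply (hA : IsIntegrablePotential A) (v w : ℝ →ᵇ (Fin n → ℂ)) :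
    hA.form v w = ∫ x, star (v x) ⬝ᵥ (A x *ᵥ w x) := rfl

lemma form_conj (hA : IsIntegrablePotential A) (v w : ℝ →ᵇ (Fin n → ℂ)) :
    (starRingEnd ℂ) (hA.form v w) = hA.form w v := by
  rw [form_apply, form_apply, ← integral_conj]
  refine integral_congr_ae (.of_forall fun x => ?_)
  simp only [starRingEnd_apply]
  rw [star_dotProduct, star_mulVec, (hA.posSemidef x).1.eq, ← dotProduct_mulVec, star_star]

lemma form_self_re_nonneg (hA : IsIntegrablePotential A) (v : ℝ →ᵇ (Fin n → ℂ)) :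
    0 ≤ (hA.form v v).re := by
  rw [form_apply, ← RCLike.re_eq_complex_re, ← integral_re (hA.integrable_form v v)]
  exact integral_nonneg fun x => (hA.posSemidef x).re_dotProduct_nonneg (v x)

lemma form_self_eq_re (hA : IsIntegrablePotential A) (v : ℝ →ᵇ (Fin n → ℂ)) :
    hA.form v v = ((hA.form v v).re : ℂ) :=
  (Complex.conj_eq_iff_re.1 (hA.form_conj v v)).symm

/-- The quadratic form `∑ₐ ∬ e^{-ε|x-y|} conj (A v)ₐ(x) (A v)ₐ(y)`. -/
noncomputable def energy (A : ℝ → Matrix (Fin n) (Fin n) ℂ) (ε : ℝ) (v : ℝ →ᵇ (Fin n → ℂ)) : ℝ :=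
  ∑ a, (kernelForm ε (fun x => (A x *ᵥ v x) a) (fun x => (A x *ᵥ v x) a)).re

lemma energy_smul (A : ℝ → Matrix (Fin n) (Fin n) ℂ) (ε : ℝ) (c : ℂ) (v : ℝ →ᵇ (Fin n → ℂ)) :
    energy A ε (c • v) = Complex.normSq c * energy A ε v := by
  rw [energy, energy, Finset.mul_sum]
  refine Finset.sum_congr rfl fun a _ => ?_
  simp only [BoundedContinuousFunction.coe_smul, Matrix.mulVec_smul, Pi.smul_apply, smul_eq_mul]
  rw [kernelForm_smul, Complex.re_ofReal_mul]

lemma energy_eq_zero (hA : IsIntegrablePotential A) {v : ℝ →ᵇ (Fin n → ℂ)}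
    (hv : (hA.form v v).re = 0) (ε : ℝ) : energy A ε v = 0 := by
  have h1 : (fun x => RCLike.re (star (v x) ⬝ᵥ (A x *ᵥ v x))) =ᵐ[volume] 0 := by
    rw [← integral_eq_zero_iff_of_nonneg (fun x => (hA.posSemidef x).re_dotProduct_nonneg (v x))
      (hA.integrable_form v v).re, integral_re (hA.integrable_form v v)]
    exact hv
  have h2 : ∀ᵐ x, A x *ᵥ v x = 0 := by
    filter_upwards [h1] with x hx
    refine ((hA.posSemidef x).dotProduct_mulVec_zero_iff (v x)).1 ?_
    have h3 := (hA.posSemidef x).dotProduct_mulVec_nonneg (v x)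
    exact Complex.ext hx (Complex.nonneg_iff.1 h3).2.symm
  have h4 : ∀ a, ∀ᵐ z : ℝ × ℝ ∂(volume.prod volume), (A z.2 *ᵥ v z.2) a = 0 := fun a =>
    (Measure.quasiMeasurePreserving_snd.ae h2).mono fun z hz => by rw [hz]; rfl
  refine Finset.sum_eq_zero fun a _ => ?_
  rw [kernelForm, integral_eq_zero_of_ae, Complex.zero_re]
  filter_upwards [h4 a] with z hz
  simp [hz]

end IsIntegrablePotential

/-- Bessel's inequality for a positive semidefinite Hermitian form. -/
lemma sum_normSq_le_of_orthonormal {X ι : Type*} [AddCommGroup X] [Module ℂ X] [Fintype ι]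
    [DecidableEq ι] (L : X →ₗ⋆[ℂ] X →ₗ[ℂ] ℂ) (hconj : ∀ v w, (starRingEnd ℂ) (L v w) = L w v)
    (hpos : ∀ v, 0 ≤ (L v v).re) {v : ι → X} (hv : ∀ i j, L (v i) (v j) = if i = j then 1 else 0)
    (e : X) : ∑ i, Complex.normSq (L (v i) e) ≤ (L e e).re := by
  set z := e - ∑ i, L (v i) e • v i with hz
  have h1 : ∀ j, L (v j) z = 0 := fun j => by simp [hz, hv]
  have h2 : L z z = L e e - ∑ i, (Complex.normSq (L (v i) e) : ℂ) := by
    have : L z z = L e z := by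
      have h3 : L z z = L e z - L (∑ i, L (v i) e • v i) z := by
        rw [← LinearMap.sub_apply, ← map_sub]
      rw [h3, map_sum, LinearMap.sum_apply]
      simp [h1]
    rw [this, hz, map_sub, map_sum]
    congr 1
    refine Finset.sum_congr rfl fun i _ => ?_
    rw [map_smul, smul_eq_mul, ← hconj (v i) e, Complex.mul_conj]
  have h3 := hpos z
  rw [h2, Complex.sub_re, Complex.re_sum] at h3
  simp only [Complex.ofReal_re] at h3
  linarith

/-! ### Ky Fan type bounds on orthonormal families -/

/-- Multiplication of a bounded function by the character `e^{2πiqx}`. -/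
noncomputable def modulateBCF {n : ℕ} (q : ℝ) (v : ℝ →ᵇ (Fin n → ℂ)) : ℝ →ᵇ (Fin n → ℂ) :=
  BoundedContinuousFunction.ofNormedAddCommGroup
    (fun x => Complex.exp (2 * Real.pi * q * x * Complex.I) • v x) (by fun_prop) ‖v‖ fun x => by
      rw [norm_smul, Complex.norm_exp]
      simpa using v.norm_coe_le_norm x

namespace IsIntegrablePotential

variable {n : ℕ} {A : ℝ → Matrix (Fin n) (Fin n) ℂ}

lemma mulVec_modulateBCF (A : ℝ → Matrix (Fin n) (Fin n) ℂ) (q : ℝ) (v : ℝ →ᵇ (Fin n → ℂ))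
    (a : Fin n) :
    (fun x => (A x *ᵥ modulateBCF q v x) a) = modulate q fun x => (A x *ᵥ v x) a := by
  ext x
  simp [modulateBCF, modulate, Matrix.mulVec_smul]

lemma form_modulateBCF (hA : IsIntegrablePotential A) (q : ℝ) (v w : ℝ →ᵇ (Fin n → ℂ)) :
    hA.form (modulateBCF q v) (modulateBCF q w) = hA.form v w := by
  rw [form_apply, form_apply]
  refine integral_congr_ae (.of_forall fun x => ?_)
  have h1 : star (Complex.exp (2 * Real.pi * q * x * Complex.I))
      * Complex.exp (2 * Real.pi * q * x * Complex.I) = 1 := by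
    rw [← starRingEnd_apply, Complex.conj_mul', Complex.norm_exp]
    simp
  simp only [modulateBCF, BoundedContinuousFunction.coe_ofNormedAddCommGroup, star_smul,
    Matrix.mulVec_smul, dotProduct_smul, smul_dotProduct, smul_eq_mul]
  rw [mul_left_comm, ← mul_assoc, h1, one_mul]

/-- The energy at `ε` of every orthonormal family of size `k` is at most `M`. -/
def EnergyBound (hA : IsIntegrablePotential A) (k : ℕ) (ε M : ℝ) : Prop :=
  ∀ v : Fin k → (ℝ →ᵇ (Fin n → ℂ)), (∀ i j, hA.form (v i) (v j) = if i = j then 1 else 0) →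
    ∑ i, energy A ε (v i) ≤ M

lemma energyBound_zero (hA : IsIntegrablePotential A) (k : ℕ) :
    hA.EnergyBound k 0 (∫ x, (A x).trace.re) := by
  intro v hv
  have h1 : ∀ a, ∑ i, Complex.normSq (∫ x, (A x *ᵥ v i x) a) ≤ ∫ x, (A x a a).re := by
    intro a
    have h2 := sum_normSq_le_of_orthonormal hA.form hA.form_conj hA.form_self_re_nonneg hv
      (BoundedContinuousFunction.const ℝ (Pi.single a 1))
    have h3 : ∀ i, Complex.normSq (hA.form (v i) (BoundedContinuousFunction.const ℝ
        (Pi.single a 1))) = Complex.normSq (∫ x, (A x *ᵥ v i x) a) := fun i => by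
      rw [← Complex.normSq_conj, form_conj, form_apply]
      congr 2
      ext x
      simp only [BoundedContinuousFunction.const_apply, ← Pi.single_star, star_one]
      rw [single_one_dotProduct]
    simp only [h3] at h2
    refine h2.trans_eq ?_
    rw [form_apply, ← RCLike.re_eq_complex_re, ← integral_re (hA.integrable_form _ _)]
    congr 1
    ext x
    simp only [BoundedContinuousFunction.const_apply, ← Pi.single_star, star_one]
    rw [single_one_dotProduct, mulVec_single_one]
    rfl
  calc ∑ i, energy A 0 (v i) = ∑ a, ∑ i, Complex.normSq (∫ x, (A x *ᵥ v i x) a) := by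
        rw [Finset.sum_comm]
        simp only [energy, kernelForm_zero, Complex.ofReal_re]
    _ ≤ ∑ a, ∫ x, (A x a a).re := Finset.sum_le_sum fun a _ => h1 a
    _ = ∫ x, (A x).trace.re := by
        rw [← integral_finsetSum (f := fun a x => (A x a a).re) _
          fun a _ => (hA.integrable_apply a a).re]
        simp [Matrix.trace]

lemma EnergyBound.mono {hA : IsIntegrablePotential A} {k : ℕ} {ε ε' M : ℝ}
    (h : hA.EnergyBound k ε M) (hε : 0 ≤ ε) (hle : ε ≤ ε') : hA.EnergyBound k ε' M := by
  obtain rfl | hlt := hle.eq_or_lt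
  · exact h
  intro v hv
  obtain ⟨μ, hμ, hμε⟩ := exists_kernelForm_add_eq_integral (sub_pos.2 hlt)
  have hi : ∀ i a, Integrable (fun q => (kernelForm ε (fun x => (A x *ᵥ modulateBCF q (v i) x) a)
      (fun x => (A x *ᵥ modulateBCF q (v i) x) a)).re) μ := fun i a => by
    simp only [mulVec_modulateBCF]
    exact (integrable_kernelForm_modulate μ hε (hA.integrable_mulVec (v i) a)).re
  have hi' : ∀ i, Integrable (fun q => energy A ε (modulateBCF q (v i))) μ := fun i =>
    integrable_finsetSum _ fun a _ => hi i a
  have h1 : ∀ i, energy A ε' (v i) = ∫ q, energy A ε (modulateBCF q (v i)) ∂μ := fun i => by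
    simp only [energy]
    rw [integral_finsetSum _ fun a _ => hi i a]
    refine Finset.sum_congr rfl fun a _ => ?_
    simp only [mulVec_modulateBCF]
    have h2 := integral_re (integrable_kernelForm_modulate μ hε (hA.integrable_mulVec (v i) a))
    simp only [RCLike.re_eq_complex_re] at h2
    rw [h2, ← hμε ε hε _ (hA.integrable_mulVec (v i) a), add_sub_cancel]
  simp only [h1]
  rw [← integral_finsetSum _ fun i _ => hi' i]
  refine (integral_mono (integrable_finsetSum _ fun i _ => hi' i) (integrable_const M)
    fun q => h _ fun i j => ?_).trans_eq (by simp)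
  rw [form_modulateBCF, hv]

/-- A family `Ψ` on which the energy is bounded below as for eigenfunctions with eigenvalues
`-E_j`. -/
def IsEigenFamily (hA : IsIntegrablePotential A) {N : ℕ} (Ψ : Fin N → (ℝ →ᵇ (Fin n → ℂ)))
    (E : Fin N → ℝ) : Prop :=
  ∀ (c : Fin N → ℂ) (ε : ℝ), 0 < ε →
    2 * ε * (hA.form (∑ i, c i • Ψ i) (∑ i, c i • Ψ i)).re
      + 2 * ε * ∑ i, (E i - ε ^ 2) * Complex.normSq (c i) ≤ energy A ε (∑ i, c i • Ψ i)

lemma IsEigenFamily.castSucc {hA : IsIntegrablePotential A} {N : ℕ}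
    {Ψ : Fin (N + 1) → (ℝ →ᵇ (Fin n → ℂ))} {E : Fin (N + 1) → ℝ} (h : hA.IsEigenFamily Ψ E) :
    hA.IsEigenFamily (fun i : Fin N => Ψ i.castSucc) (fun i => E i.castSucc) := by
  intro c ε hε
  obtain ⟨d, hd, hd0⟩ : ∃ d : Fin (N + 1) → ℂ, (∀ i, d (Fin.castSucc i) = c i) ∧
      d (Fin.last N) = 0 := ⟨Fin.snoc c 0, by simp, by simp⟩
  have := h d ε hε
  have e : ∑ i, d i • Ψ i = ∑ i, c i • Ψ i.castSucc := by
    have h0 : (0 : ℂ) • Ψ (Fin.last N) = 0 := by ext x b; simp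
    rw [Fin.sum_univ_castSucc, hd0, h0, add_zero]
    simp only [hd]
  rw [e] at this
  simpa only [Fin.sum_univ_castSucc, hd, hd0, Complex.normSq_zero, mul_zero, add_zero] using this

lemma IsEigenFamily.form_pos {hA : IsIntegrablePotential A} {N : ℕ}
    {Ψ : Fin (N + 1) → (ℝ →ᵇ (Fin n → ℂ))} {E : Fin (N + 1) → ℝ} (h : hA.IsEigenFamily Ψ E)
    (hE : ∀ i, 0 < E i) (hanti : Antitone E) {c : Fin (N + 1) → ℂ} (hc : c ≠ 0) :
    0 < (hA.form (∑ i, c i • Ψ i) (∑ i, c i • Ψ i)).re := by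
  refine (hA.form_self_re_nonneg _).lt_of_ne fun h0 => hc ?_
  set e := E (Fin.last N) with he
  have he0 : 0 < e := hE _
  have hε : 0 < Real.sqrt (e / 2) := Real.sqrt_pos.2 (by positivity)
  have h1 := h c _ hε
  rw [← h0, hA.energy_eq_zero h0.symm, mul_zero, zero_add, Real.sq_sqrt (by positivity)] at h1
  have h2 : ∀ i, 0 ≤ (E i - e / 2) * Complex.normSq (c i) := fun i =>
    mul_nonneg (by linarith [hanti (Fin.le_last i)]) (Complex.normSq_nonneg _)
  have h3 : ∑ i, (E i - e / 2) * Complex.normSq (c i) = 0 := by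
    refine le_antisymm ?_ (Finset.sum_nonneg fun i _ => h2 i)
    by_contra! h4
    have : 0 < 2 * Real.sqrt (e / 2) * ∑ i, (E i - e / 2) * Complex.normSq (c i) := by positivity
    linarith
  rw [Finset.sum_eq_zero_iff_of_nonneg fun i _ => h2 i] at h3
  ext i
  have h4 := h3 i (Finset.mem_univ _)
  have h5 : E i - e / 2 ≠ 0 := by
    have := hanti (Fin.le_last i)
    exact ne_of_gt (by linarith)
  simpa [h5] using h4

lemma EnergyBound.pred {hA : IsIntegrablePotential A} {N : ℕ}
    {Ψ : Fin (N + 1) → (ℝ →ᵇ (Fin n → ℂ))} {E : Fin (N + 1) → ℝ} (h : hA.IsEigenFamily Ψ E)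
    (hE : ∀ i, 0 < E i) (hanti : Antitone E) {M : ℝ}
    (hM : hA.EnergyBound (N + 1) (Real.sqrt (E (Fin.last N))) M) :
    hA.EnergyBound N (Real.sqrt (E (Fin.last N))) (M - 2 * Real.sqrt (E (Fin.last N))) := by
  intro v hv
  set ε := Real.sqrt (E (Fin.last N)) with hεdef
  have hε : 0 < ε := Real.sqrt_pos.2 (hE _)
  have hε2 : ε ^ 2 = E (Fin.last N) := Real.sq_sqrt (hE _).le
  let f : (Fin (N + 1) → ℂ) →ₗ[ℂ] (Fin N → ℂ) :=
    LinearMap.pi fun i => (hA.form (v i)) ∘ₗ (Fintype.linearCombination ℂ Ψ)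
  obtain ⟨c, hcf, hc⟩ := (Submodule.ne_bot_iff _).1
    (LinearMap.ker_ne_bot_of_finrank_lt (f := f) (by simp))
  set w := ∑ i, c i • Ψ i with hw
  have hort : ∀ i, hA.form (v i) w = 0 := fun i => by
    have := congrFun (LinearMap.mem_ker.1 hcf) i
    simpa [f, Fintype.linearCombination_apply, hw] using this
  set β := (hA.form w w).re with hβ
  have hβ0 : 0 < β := h.form_pos hE hanti hc
  set t : ℝ := (Real.sqrt β)⁻¹ with ht
  have ht2 : t * t * β = 1 := by
    rw [ht, ← mul_inv, Real.mul_self_sqrt hβ0.le, inv_mul_cancel₀ hβ0.ne']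
  have hlow : 2 * ε * β ≤ energy A ε w := by
    have h1 := h c ε hε
    have h2 : 0 ≤ ∑ i, (E i - ε ^ 2) * Complex.normSq (c i) :=
      Finset.sum_nonneg fun i _ => mul_nonneg
        (by rw [hε2]; linarith [hanti (Fin.le_last i)]) (Complex.normSq_nonneg _)
    have h3 : 0 ≤ 2 * ε * ∑ i, (E i - ε ^ 2) * Complex.normSq (c i) := by positivity
    linarith
  have horth' : ∀ i, hA.form w (v i) = 0 := fun i => by rw [← hA.form_conj, hort, map_zero]
  have h1 := hM (Fin.cons ((t : ℂ) • w) v) ?_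
  · rw [Fin.sum_univ_succ] at h1
    simp only [Fin.cons_zero, Fin.cons_succ, energy_smul, Complex.normSq_ofReal] at h1
    have h2 : 2 * ε ≤ t * t * energy A ε w := by
      calc 2 * ε = t * t * (2 * ε * β) := by linear_combination (-2 * ε) * ht2
        _ ≤ _ := mul_le_mul_of_nonneg_left hlow (mul_self_nonneg t)
    linarith
  · intro i j
    refine Fin.cases ?_ (fun i => ?_) i <;> refine Fin.cases ?_ (fun j => ?_) j
    · simp only [Fin.cons_zero, map_smul, LinearMap.map_smulₛₗ, LinearMap.smul_apply, smul_eq_mul,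
        Complex.conj_ofReal]
      rw [hA.form_self_eq_re w, ← hβ, if_pos trivial]
      exact_mod_cast (mul_assoc t t β).symm.trans ht2
    · simp [horth', (Fin.succ_ne_zero j).symm]
    · simp [hort]
    · simp [hv]

lemma two_mul_sum_sqrt_le (hA : IsIntegrablePotential A) {N : ℕ}
    (Ψ : Fin N → (ℝ →ᵇ (Fin n → ℂ))) (E : Fin N → ℝ) (h : hA.IsEigenFamily Ψ E)
    (hE : ∀ i, 0 < E i) (hanti : Antitone E) {ε M : ℝ} (hε : 0 ≤ ε)
    (hεE : ∀ i, ε ≤ Real.sqrt (E i)) (hM : hA.EnergyBound N ε M) :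
    2 * ∑ i, Real.sqrt (E i) ≤ M := by
  induction N generalizing ε M with
  | zero => simpa using hM (fun i => i.elim0) (fun i => i.elim0)
  | succ N ih =>
    have h1 := EnergyBound.pred h hE hanti (hM.mono hε (hεE _))
    have h2 := ih _ _ h.castSucc (fun i => hE _)
      (fun i j hij => hanti (Fin.castSucc_le_castSucc_iff.2 hij)) (Real.sqrt_nonneg _)
      (fun i => Real.sqrt_le_sqrt (hanti (Fin.le_last _))) h1
    rw [Fin.sum_univ_castSucc]
    linarith

end IsIntegrablePotential

/-! ### Eigenfunctions -/

/-- `ψ` solves `-ψ'' - A ψ = -E ψ`, with derivative `ψ'`. -/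
structure IsEigenSolution {n : ℕ} (A : ℝ → Matrix (Fin n) (Fin n) ℂ) (E : ℝ)
    (ψ ψ' : ℝ → Fin n → ℂ) : Prop where
  hasDerivAt : ∀ i x, HasDerivAt (fun y => ψ y i) (ψ' x i) x
  hasDerivAt' : ∀ i x, HasDerivAt (fun y => ψ' y i) (E * ψ x i - (A x *ᵥ ψ x) i) x

namespace IsEigenSolution

variable {n : ℕ} {A : ℝ → Matrix (Fin n) (Fin n) ℂ} {E : ℝ} {ψ ψ' : ℝ → Fin n → ℂ}

lemma continuous (h : IsEigenSolution A E ψ ψ') : Continuous ψ :=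
  continuous_pi fun i => continuous_iff_continuousAt.2 fun x => (h.hasDerivAt i x).continuousAt

lemma continuous' (h : IsEigenSolution A E ψ ψ') : Continuous ψ' :=
  continuous_pi fun i => continuous_iff_continuousAt.2 fun x => (h.hasDerivAt' i x).continuousAt

lemma exists_norm_le (h : IsEigenSolution A E ψ ψ') (hA : IsIntegrablePotential A) (hE : 0 ≤ E)
    (hL2 : Integrable fun x => ∑ i, Complex.normSq (ψ x i)) : ∃ C, ∀ x, ‖ψ x‖ ≤ C := by
  have hc := h.continuous
  have hc' := h.continuous'
  have hAc := hA.continuous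
  have hre : ∀ {f : ℝ → ℂ} {f' : ℂ} {x : ℝ}, HasDerivAt f f' x →
      HasDerivAt (fun y => (f y).re) f'.re x := fun hf =>
    Complex.reCLM.hasFDerivAt.comp_hasDerivAt _ hf
  have him : ∀ {f : ℝ → ℂ} {f' : ℂ} {x : ℝ}, HasDerivAt f f' x →
      HasDerivAt (fun y => (f y).im) f'.im x := fun hf =>
    Complex.imCLM.hasFDerivAt.comp_hasDerivAt _ hf
  obtain ⟨C, hC⟩ := exists_forall_le_of_hasDerivAt (E := E) hE
    (h := fun x => ∑ i, Complex.normSq (ψ x i))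
    (p := fun x => ∑ i, ((ψ x i).re * (ψ' x i).re + (ψ x i).im * (ψ' x i).im))
    (s := fun x => ∑ i, Complex.normSq (ψ' x i))
    (w := fun x => ∑ i, ((ψ x i).re * ((A x *ᵥ ψ x) i).re + (ψ x i).im * ((A x *ᵥ ψ x) i).im))
    (τ := fun x => n * (A x).trace.re)
    (fun x => by
      simp only [Complex.normSq_apply, Finset.mul_sum]
      refine HasDerivAt.fun_sum fun i _ => ?_
      have h1 := hre (h.hasDerivAt i x)
      have h2 := him (h.hasDerivAt i x)
      exact ((h1.mul h1).add (h2.mul h2)).congr_deriv (by ring))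
    (fun x => by
      simp only [Complex.normSq_apply, Finset.mul_sum, ← Finset.sum_add_distrib,
        ← Finset.sum_sub_distrib]
      refine HasDerivAt.fun_sum fun i _ => ?_
      have h1 := hre (h.hasDerivAt i x)
      have h2 := him (h.hasDerivAt i x)
      have h3 := hre (h.hasDerivAt' i x)
      have h4 := him (h.hasDerivAt' i x)
      refine ((h1.mul h3).add (h2.mul h4)).congr_deriv ?_
      simp only [Complex.sub_re, Complex.sub_im, Complex.re_ofReal_mul, Complex.im_ofReal_mul]
      ring)
    (fun x α β => by
      simp only [Complex.normSq_apply, Finset.mul_sum, ← Finset.sum_add_distrib]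
      refine Finset.sum_nonneg fun i _ => ?_
      nlinarith [sq_nonneg (α * (ψ x i).re + β * (ψ' x i).re),
        sq_nonneg (α * (ψ x i).im + β * (ψ' x i).im)])
    (fun x => by
      have h1 : ∀ i b, ‖(starRingEnd ℂ) (ψ x i) * (A x i b * ψ x b)‖
          ≤ (A x).trace.re * ((Complex.normSq (ψ x i) + Complex.normSq (ψ x b)) / 2) := by
        intro i b
        rw [norm_mul, norm_mul, RCLike.norm_conj, Complex.normSq_eq_norm_sq,
          Complex.normSq_eq_norm_sq]
        have h2 := (hA.posSemidef x).norm_apply_le_trace i b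
        calc ‖ψ x i‖ * (‖A x i b‖ * ‖ψ x b‖) = ‖A x i b‖ * (‖ψ x i‖ * ‖ψ x b‖) := by ring
          _ ≤ _ := by
            gcongr
            · exact (norm_nonneg _).trans h2
            · nlinarith [sq_nonneg (‖ψ x i‖ - ‖ψ x b‖)]
      calc ∑ i, ((ψ x i).re * ((A x *ᵥ ψ x) i).re + (ψ x i).im * ((A x *ᵥ ψ x) i).im)
          = (∑ i, ∑ b, (starRingEnd ℂ) (ψ x i) * (A x i b * ψ x b)).re := by
            simp only [← Finset.mul_sum, Complex.re_sum]
            refine Finset.sum_congr rfl fun i _ => ?_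
            rw [Complex.mul_re, Complex.conj_re, Complex.conj_im, Matrix.mulVec, dotProduct]
            ring
        _ ≤ ∑ i, ∑ b, (A x).trace.re * ((Complex.normSq (ψ x i) + Complex.normSq (ψ x b)) / 2) :=
            (Complex.re_le_norm _).trans
              (norm_sum_le_of_le _ fun i _ => norm_sum_le_of_le _ fun b _ => h1 i b)
        _ = _ := by
            simp only [← Finset.mul_sum, ← Finset.sum_div, Finset.sum_add_distrib,
              Finset.sum_const, Finset.card_univ, Fintype.card_fin, nsmul_eq_mul]
            ring)
    (fun x => mul_nonneg n.cast_nonneg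
      (Complex.nonneg_iff.1 (hA.posSemidef x).trace_nonneg).1)
    (by simp only [Complex.normSq_apply]; fun_prop)
    (by
      have : ∀ i, Continuous fun x => (A x *ᵥ ψ x) i := fun i =>
        (_root_.continuous_apply i).comp (hAc.matrix_mulVec hc)
      fun_prop)
    (by
      have := hAc.matrix_trace
      fun_prop)
    hL2 (hA.integrable_trace.const_mul _)
  refine ⟨Real.sqrt C, fun x => (pi_norm_le_iff_of_nonneg (Real.sqrt_nonneg _)).2 fun i => ?_⟩
  refine Real.le_sqrt_of_sq_le (le_trans ?_ (hC x))
  rw [← Complex.normSq_eq_norm_sq]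
  exact Finset.single_le_sum (f := fun i => Complex.normSq (ψ x i))
    (fun i _ => Complex.normSq_nonneg _) (Finset.mem_univ i)

end IsEigenSolution

namespace IsIntegrablePotential

variable {n : ℕ} {A : ℝ → Matrix (Fin n) (Fin n) ℂ}

lemma integrable_apply_of_isEigenSolution (hA : IsIntegrablePotential A) {E : ℝ} (hE : 0 < E)
    {v : ℝ →ᵇ (Fin n → ℂ)} {ψ' : ℝ → Fin n → ℂ} (h : IsEigenSolution A E v ψ') (a : Fin n) :
    Integrable fun x => v x a := by
  refine integrable_of_bounded_of_hasDerivAt (Real.sqrt_pos.2 hE) (h.hasDerivAt a)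
    (fun x => ?_) (fun x => (norm_le_pi_norm (v x) a).trans (v.norm_coe_le_norm x))
    (hA.integrable_mulVec v a) (hA.continuous_mulVec v a)
  rw [← Complex.ofReal_pow, Real.sq_sqrt hE.le]
  exact h.hasDerivAt' a x

lemma isEigenFamily_of_isEigenSolution (hA : IsIntegrablePotential A) {N : ℕ}
    {Ψ : Fin N → (ℝ →ᵇ (Fin n → ℂ))} {Ψ' : Fin N → ℝ → Fin n → ℂ} {E : Fin N → ℝ}
    (hE : ∀ j, 0 < E j) (h : ∀ j, IsEigenSolution A (E j) (Ψ j) (Ψ' j))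
    (horth : ∀ j l, (∫ x : ℝ, ∑ i, (starRingEnd ℂ) (Ψ j x i) * Ψ l x i)
      = if j = l then 1 else 0) : hA.IsEigenFamily Ψ E := by
  intro c ε hε
  set w := ∑ i, c i • Ψ i with hw
  have hwa : ∀ x a, w x a = ∑ i, c i * Ψ i x a := fun x a => by
    simp [hw, Finset.sum_apply]
  have hwm : ∀ x a, (A x *ᵥ w x) a = ∑ i, c i * (A x *ᵥ Ψ i x) a := fun x a => by
    have : w x = ∑ i, c i • Ψ i x := by ext a; simp [hwa]
    rw [this, Matrix.mulVec_sum]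
    simp [Matrix.mulVec_smul]
  have hΨi : ∀ j a, Integrable fun x => Ψ j x a := fun j a =>
    hA.integrable_apply_of_isEigenSolution (hE j) (h j) a
  set g : Fin n → ℝ → ℂ := fun a x => ∑ i, ((E i - ε ^ 2 : ℝ) : ℂ) * c i * Ψ i x a with hg
  have hgi : ∀ a, Integrable (g a) := fun a =>
    integrable_finsetSum _ fun i _ => (hΨi i a).const_mul _
  have hgc : ∀ a, Continuous (g a) := fun a => by
    simp only [hg]
    fun_prop
  have hfi := hA.integrable_mulVec w
  have hle : ∀ x a, ‖w x a‖ ≤ ‖w‖ := fun x a =>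
    (norm_le_pi_norm (w x) a).trans (w.norm_coe_le_norm x)
  have hu : ∀ a x, ∫ y, (Real.exp (-ε * |x - y|) : ℂ) * ((A y *ᵥ w y) a - g a y)
      = 2 * ε * w x a := by
    intro a x
    refine integral_exp_kernel_eq (u := fun x => w x a) (u' := fun x => ∑ i, c i * Ψ' i x a) hε
      (fun x => ?_) (fun x => ?_) (fun x => hle x a) ((hfi a).sub (hgi a))
      ((hA.continuous_mulVec w a).sub (hgc a)) x
    · simp only [hwa]
      exact HasDerivAt.fun_sum fun i _ => ((h i).hasDerivAt a x).const_mul (c i)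
    · refine (HasDerivAt.fun_sum fun i _ =>
        ((h i).hasDerivAt' a x).const_mul (c i)).congr_deriv ?_
      simp only [Pi.sub_apply, hwa, hwm, hg]
      rw [Finset.mul_sum, ← Finset.sum_sub_distrib, ← Finset.sum_sub_distrib]
      refine Finset.sum_congr rfl fun i _ => ?_
      push_cast
      ring
  have key := Finset.sum_le_sum fun a (_ : a ∈ Finset.univ) =>
    two_mul_le_kernelForm_re hε (hfi a) (hgi a) (hu a)
  rw [Finset.sum_add_distrib, ← Finset.mul_sum, ← Finset.mul_sum] at key
  have e1 : ∑ a, (∫ x, (starRingEnd ℂ) ((A x *ᵥ w x) a) * w x a).re = (hA.form w w).re := by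
    have hi : ∀ a, Integrable fun x => (starRingEnd ℂ) ((A x *ᵥ w x) a) * w x a := fun a =>
      (integrable_conj (hfi a)).mul_bdd (c := ‖w‖)
        (Continuous.aestronglyMeasurable (by fun_prop)) (.of_forall fun x => hle x a)
    rw [← Complex.re_sum, ← integral_finsetSum _ fun a _ => hi a, ← hA.form_conj, form_apply,
      ← integral_conj]
    congr 2
    ext x
    simp [dotProduct, mul_comm]
  have e2 : ∑ a, (∫ x, (starRingEnd ℂ) (g a x) * w x a).re
      = ∑ i, (E i - ε ^ 2) * Complex.normSq (c i) := by
    have hi : ∀ i j a, Integrable fun x => (starRingEnd ℂ) (Ψ i x a) * Ψ j x a := fun i j a =>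
      (integrable_conj (hΨi i a)).mul_bdd (c := ‖Ψ j‖)
        (Continuous.aestronglyMeasurable (by fun_prop))
        (.of_forall fun x => (norm_le_pi_norm (Ψ j x) a).trans ((Ψ j).norm_coe_le_norm x))
    have hij : ∀ i j, Integrable fun x => ((E i - ε ^ 2 : ℝ) : ℂ) * (starRingEnd ℂ) (c i) * c j
        * ∑ a, (starRingEnd ℂ) (Ψ i x a) * Ψ j x a := fun i j =>
      (integrable_finsetSum _ fun a _ => hi i j a).const_mul _
    have hi' : ∀ a, Integrable fun x => (starRingEnd ℂ) (g a x) * w x a := fun a =>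
      (integrable_conj (hgi a)).mul_bdd (c := ‖w‖)
        (Continuous.aestronglyMeasurable (by fun_prop)) (.of_forall fun x => hle x a)
    have e3 : ∀ x, ∑ a, (starRingEnd ℂ) (g a x) * w x a = ∑ i, ∑ j,
        ((E i - ε ^ 2 : ℝ) : ℂ) * (starRingEnd ℂ) (c i) * c j
          * ∑ a, (starRingEnd ℂ) (Ψ i x a) * Ψ j x a := fun x => by
      simp only [hg, hwa, map_sum, map_mul, Complex.conj_ofReal, Finset.sum_mul_sum]
      simp only [Finset.mul_sum]
      rw [Finset.sum_comm]
      refine Finset.sum_congr rfl fun i _ => ?_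
      rw [Finset.sum_comm]
      refine Finset.sum_congr rfl fun j _ => Finset.sum_congr rfl fun a _ => ?_
      ring
    rw [← Complex.re_sum, ← integral_finsetSum _ fun a _ => hi' a]
    simp only [e3]
    rw [integral_finsetSum _ fun i _ => integrable_finsetSum _ fun j _ => hij i j,
      Complex.re_sum]
    refine Finset.sum_congr rfl fun i _ => ?_
    rw [integral_finsetSum _ fun j _ => hij i j]
    simp only [integral_const_mul, horth, mul_ite, mul_one, mul_zero, Finset.sum_ite_eq,
      Finset.mem_univ, if_true]
    rw [mul_assoc, mul_comm ((starRingEnd ℂ) _), Complex.mul_conj, Complex.re_ofReal_mul,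
      Complex.ofReal_re]
  rw [e1, e2] at key
  exact key

end IsIntegrablePotential

/-- **Sharp Lieb–Thirring bound for `γ = 1/2`, `d = 1`, matrix potentials.**
If `-E_1, …, -E_N` are negative eigenvalues (with orthonormal eigenfunctions
`ψ_1, …, ψ_N`) of the matrix Schrödinger operator `-d²/dx² ⊗ 1 + V` with a continuous,
Hermitian, nonpositive matrix potential `V` such that `tr(-V)` is integrable, then
`∑ √E_j ≤ (1/2) ∫ tr(-V) dx`. -/
theorem lieb_thirring_half_one_matrix (n : ℕ) (hn : 1 ≤ n)
    (V : ℝ → Matrix (Fin n) (Fin n) ℂ)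
    (hVcont : Continuous V)
    (hV : ∀ x, (-(V x)).PosSemidef)
    (hVint : Integrable fun x => ((-(V x)).trace).re)
    (N : ℕ) (ψ : Fin N → ℝ → Fin n → ℂ) (E : Fin N → ℝ)
    (hE : ∀ j, 0 < E j)
    (hψC2 : ∀ j i, ContDiff ℝ 2 fun x => ψ j x i)
    (hψL2 : ∀ j, Integrable fun x => ∑ i, Complex.normSq (ψ j x i))
    (horth : ∀ j l, (∫ x : ℝ, ∑ i, (starRingEnd ℂ) (ψ j x i) * ψ l x i)
      = if j = l then 1 else 0)
    (heq : ∀ j x i,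
      -(deriv (fun y => deriv (fun z => ψ j z i) y) x) + (V x *ᵥ ψ j x) i
        = -(E j : ℂ) * ψ j x i) :
    ∑ j, Real.sqrt (E j) ≤ (1 / 2) * ∫ x : ℝ, ((-(V x)).trace).re := by
  have hA : IsIntegrablePotential fun x => -(V x) := ⟨hVcont.neg, hV, hVint⟩
  have hsol : ∀ j, IsEigenSolution (fun x => -(V x)) (E j) (ψ j)
      fun x i => deriv (fun z => ψ j z i) x := fun j => by
    refine ⟨fun i x => ((hψC2 j i).differentiable (by norm_num) x).hasDerivAt, fun i x => ?_⟩
    have h2 : ContDiff ℝ (1 + 1) fun x => ψ j x i := by simpa [one_add_one_eq_two] using hψC2 j i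
    have h1 := (((contDiff_succ_iff_deriv.1 h2).2.2).differentiable (by norm_num) x).hasDerivAt
    refine h1.congr_deriv ?_
    rw [Matrix.neg_mulVec, Pi.neg_apply]
    linear_combination -heq j x i
  have hb := fun j => (hsol j).exists_norm_le hA (hE j).le (hψL2 j)
  choose C hC using hb
  let Ψ : Fin N → (ℝ →ᵇ (Fin n → ℂ)) := fun j =>
    .ofNormedAddCommGroup (ψ j) (hsol j).continuous (C j) (hC j)
  set σ := Tuple.sort fun j => -E j with hσ
  have hanti : Antitone fun j => E (σ j) := fun i j hij =>
    neg_le_neg_iff.1 (Tuple.monotone_sort (fun j => -E j) hij)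
  have hfam : hA.IsEigenFamily (fun j => Ψ (σ j)) fun j => E (σ j) :=
    hA.isEigenFamily_of_isEigenSolution (fun j => hE _) (fun j => hsol (σ j)) fun j l => by
      simpa [Ψ] using horth (σ j) (σ l)
  have := hA.two_mul_sum_sqrt_le _ _ hfam (fun j => hE _) hanti le_rfl
    (fun j => Real.sqrt_nonneg _) (hA.energyBound_zero N)
  rw [Equiv.sum_comp σ fun j => Real.sqrt (E j)] at this
  linarith
end
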